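/- For all g, h ∈ Γ and every index i, the preferred longitudes satisfy y_i(h·g·h⁻¹) = ρ(hg)(y_i(h⁻¹)) · ρ(h)(y_i(g)) · y_i(h). (Discrete-group form of Lemma 2.2.5(3).) -/

import Mathlib

/-- The `x_i`-exponent sum homomorphism `σ_i : F_r → ℤ` (written multiplicatively). -/
def expSum {r : ℕ} (i : Fin r) : FreeGroup (Fin r) →* Multiplicative ℤ :=
  FreeGroup.lift fun j => Multiplicative.ofAdd (if j = i then (1 : ℤ) else 0)

namespace FreeGroup

/-- A reduced word commuting with a positive power of a generator is a power of that generator. -/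
theorem IsReduced.mk_mem_zpowers_of_commute {α : Type*} {a : α} {n : ℕ} (hn : n ≠ 0)
    {L : List (α × Bool)} (hL : IsReduced L) (hcomm : Commute (mk L) (of a ^ n)) :
    mk L ∈ Subgroup.zpowers (of a) := by
  classical
  induction L with
  | nil => exact Subgroup.one_mem _
  | cons p L ih =>
    obtain ⟨x, b⟩ := p
    have hpow : of a ^ n = mk (List.replicate n (a, true)) := by
      rw [← toWord_of_pow, mk_toWord]
    by_cases hx : x = a
    · subst hx
      have hu : mk [(x, b)] ∈ Subgroup.zpowers (of x) := by
        cases b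
        · exact Subgroup.inv_mem _ (Subgroup.mem_zpowers (of x))
        · exact Subgroup.mem_zpowers (of x)
      have hsplit : mk ((x, b) :: L) = mk [(x, b)] * mk L := by rw [mul_mk]; rfl
      have hucomm : Commute (mk [(x, b)]) (of x ^ n) := by
        obtain ⟨k, hk⟩ := Subgroup.mem_zpowers_iff.1 hu
        rw [← hk]
        exact ((Commute.refl (of x)).zpow_left k).pow_right n
      rw [hsplit] at hcomm ⊢
      refine Subgroup.mul_mem _ hu (ih (hL.infix (List.suffix_cons _ _).isInfix) ?_)
      simpa only [inv_mul_cancel_left] using hucomm.inv_left.mul_left hcomm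
    · have hred : IsReduced (List.replicate n (a, true) ++ (x, b) :: L) := by
        refine List.isChain_append.2 ⟨List.isChain_replicate_of_rel _ fun _ => rfl, hL, ?_⟩
        intro p hp q hq hpq
        obtain rfl : p = (a, true) := List.eq_of_mem_replicate (List.mem_of_mem_getLast? hp)
        obtain rfl : (x, b) = q := by simpa using hq
        exact absurd hpq.symm hx
      have hmk : mk ((x, b) :: L ++ List.replicate n (a, true)) =
          mk (List.replicate n (a, true) ++ (x, b) :: L) := by
        rw [← mul_mk, ← mul_mk, ← hpow]
        exact hcomm
      have hsub : Red ((x, b) :: L ++ List.replicate n (a, true))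
          (List.replicate n (a, true) ++ (x, b) :: L) := by
        rw [← hred.reduce_eq, ← reduce.sound hmk]
        exact reduce.red
      have heq := hsub.sublist.eq_of_length (by simp; omega)
      obtain ⟨m, rfl⟩ := Nat.exists_eq_succ_of_ne_zero hn
      rw [List.replicate_succ, List.cons_append, List.cons_append, List.cons.injEq,
        Prod.mk.injEq] at heq
      exact absurd heq.1.1.symm hx

/-- The centralizer of a nontrivial power of a generator consists of powers of that generator. -/
theorem mem_zpowers_of_commute_zpow {α : Type*} {a : α} {n : ℤ} (hn : n ≠ 0)
    {z : FreeGroup α} (hz : Commute z (of a ^ n)) : z ∈ Subgroup.zpowers (of a) := by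
  classical
  have hz' : Commute z (of a ^ n.natAbs) := by
    rcases Int.natAbs_eq n with h | h
    · rwa [h, zpow_natCast] at hz
    · rw [h, zpow_neg, zpow_natCast] at hz
      exact Commute.inv_right_iff.1 hz
  rw [← mk_toWord (x := z)] at hz' ⊢
  exact isReduced_toWord.mk_mem_zpowers_of_commute (Int.natAbs_ne_zero.2 hn) hz'

end FreeGroup

theorem expSum_of_self {r : ℕ} (i : Fin r) :
    expSum i (FreeGroup.of i) = Multiplicative.ofAdd 1 := by
  simp [expSum]

theorem expSum_of_zpow_self {r : ℕ} (i : Fin r) (k : ℤ) :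
    expSum i (FreeGroup.of i ^ k) = Multiplicative.ofAdd k := by
  rw [map_zpow, expSum_of_self, ← ofAdd_zsmul, zsmul_one, Int.cast_id]

/-- A conjugate of a nontrivial power of `x_i` determines the exponent, and determines the
conjugating element among those of `x_i`-exponent sum zero. -/
theorem eq_of_conj_zpow_eq {r : ℕ} {i : Fin r} {m n : ℤ} (hm : m ≠ 0)
    {a b : FreeGroup (Fin r)} (ha : expSum i a = 1) (hb : expSum i b = 1)
    (h : a * FreeGroup.of i ^ m * a⁻¹ = b * FreeGroup.of i ^ n * b⁻¹) : a = b := by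
  obtain rfl : m = n := by
    have := congrArg (expSum i) h
    simpa only [map_mul, map_inv, ha, hb, expSum_of_zpow_self, one_mul, inv_one, mul_one,
      EmbeddingLike.apply_eq_iff_eq] using this
  have hcomm : Commute (b⁻¹ * a) (FreeGroup.of i ^ m) := by
    have h' : b⁻¹ * (a * FreeGroup.of i ^ m * a⁻¹) * a =
        b⁻¹ * (b * FreeGroup.of i ^ m * b⁻¹) * a := by rw [h]
    rw [commute_iff_eq]
    simpa [mul_assoc] using h'
  obtain ⟨k, hk⟩ := Subgroup.mem_zpowers_iff.1
    (FreeGroup.mem_zpowers_of_commute_zpow hm hcomm)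
  have hk0 : k = 0 := by
    have := congrArg (expSum i) hk
    rw [expSum_of_zpow_self, map_mul, map_inv, ha, hb, inv_one, one_mul] at this
    exact ofAdd_eq_one.1 this
  rw [hk0, zpow_zero] at hk
  exact (inv_mul_eq_one.1 hk.symm).symm

/-- An endomorphism sending each generator to a conjugate of its `c`-th power multiplies
exponent sums by `c`. -/
theorem expSum_apply_of_conj_zpow {r : ℕ} {φ : MulAut (FreeGroup (Fin r))} {c : ℤ}
    {y : Fin r → FreeGroup (Fin r)}
    (hφ : ∀ j, φ (FreeGroup.of j) = y j * FreeGroup.of j ^ c * (y j)⁻¹)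
    (i : Fin r) (w : FreeGroup (Fin r)) : expSum i (φ w) = expSum i w ^ c := by
  have h : (expSum i).comp φ.toMonoidHom = (zpowGroupHom c).comp (expSum i) := by
    ext j
    simp [hφ]
  exact DFunLike.congr_fun h w

/-- Discrete-group form of Lemma 2.2.5(3):
`y_i(hgh⁻¹) = ρ(hg)(y_i(h⁻¹)) · ρ(h)(y_i(g)) · y_i(h)`. -/
theorem longitude_conj {r : ℕ} {Γ : Type*} [Group Γ]
    (ρ : Γ →* MulAut (FreeGroup (Fin r)))
    (c : Γ → ℤ) (hc : ∀ g, c g ≠ 0)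
    (hconj : ∀ (g : Γ) (j : Fin r),
      IsConj (FreeGroup.of j ^ c g) (ρ g (FreeGroup.of j)))
    (y : Γ → Fin r → FreeGroup (Fin r))
    (hy1 : ∀ (g : Γ) (i : Fin r),
      ρ g (FreeGroup.of i) = y g i * FreeGroup.of i ^ c g * (y g i)⁻¹)
    (hy2 : ∀ (g : Γ) (i : Fin r), expSum i (y g i) = 1)
    (g h : Γ) (i : Fin r) :
    y (h * g * h⁻¹) i = ρ (h * g) (y (h⁻¹) i) * ρ h (y g i) * y h i := by
  have cocycle (g h : Γ) : y (g * h) i = ρ g (y h i) * y g i := by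
    refine eq_of_conj_zpow_eq (n := c g * c h) (hc (g * h)) (hy2 _ i) ?_ ?_
    · rw [map_mul, hy2, expSum_apply_of_conj_zpow (hy1 g), hy2, one_zpow, one_mul]
    · rw [← hy1, map_mul, MulAut.mul_apply, hy1 h, map_mul, map_mul, map_inv, map_zpow, hy1 g,
        conj_zpow, ← zpow_mul, mul_inv_rev]
      simp only [mul_assoc]
  rw [cocycle (h * g), cocycle h, mul_assoc]
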